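/- Let G be a subgroup of the Weyl group W(E₆) of order 960 which contains an element of order 5 that does not lie in the center of G. Then the centralizer of G in W(E₆) is trivial. (In particular, the subgroups of W(E₆) isomorphic to (ℤ/2ℤ)⁴ ⋊ 𝔄₅, of order 960, and any subgroups containing them, such as PSU₄(𝔽₂) of order 25920, have trivial centralizer in W(E₆).) -/

import Mathlib

/-- The Weyl group of type `E₆`, presented as the Coxeter group of the `E₆` Coxeter
matrix. -/
abbrev WE6 : Type _ := CoxeterMatrix.E₆.Group

namespace WE6

open CoxeterMatrix

/-- The Coxeter system on `W(E₆)`. -/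
abbrev cs : CoxeterSystem E₆ WE6 := E₆.toCoxeterSystem

/-- Rewrite the word `w` by braid and commutation moves so that it starts with `s`, and return the
remaining letters. The natural number bounds the depth of the recursion. -/
def pull : ℕ → Fin 6 → List (Fin 6) → Option (List (Fin 6))
  | 0, _, _ => none
  | _ + 1, _, [] => none
  | n + 1, s, t :: w =>
    if s = t then some w
    else if E₆ s t = 2 then (pull n s w).map (t :: ·)
    else if E₆ s t = 3 then ((pull n s w).bind (pull n t)).map (fun v => t :: s :: v)
    else none

theorem simple_comm {s t : Fin 6} (h : E₆ s t = 2) :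
    cs.simple s * cs.simple t = cs.simple t * cs.simple s := by
  have h1 := cs.simple_mul_simple_pow s t
  rw [h, pow_two, mul_eq_one_iff_eq_inv] at h1
  simpa only [mul_inv_rev, cs.inv_simple] using h1

theorem simple_braid {s t : Fin 6} (h : E₆ s t = 3) :
    cs.simple s * cs.simple t * cs.simple s = cs.simple t * cs.simple s * cs.simple t := by
  have h1 := cs.simple_mul_simple_pow s t
  have h2 : (cs.simple s * cs.simple t * cs.simple s) *
      (cs.simple t * cs.simple s * cs.simple t) = 1 := by
    rw [← h1, h]; simp only [pow_succ, pow_zero, one_mul, mul_assoc]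
  rw [mul_eq_one_iff_eq_inv] at h2
  simpa only [mul_inv_rev, cs.inv_simple, mul_assoc] using h2

theorem wordProd_pull {n : ℕ} {s : Fin 6} {w v : List (Fin 6)} (h : pull n s w = some v) :
    cs.wordProd w = cs.simple s * cs.wordProd v := by
  induction n generalizing s w v with
  | zero => simp [pull] at h
  | succ n ih =>
    cases w with
    | nil => simp [pull] at h
    | cons t w =>
      rw [pull] at h
      split_ifs at h with h1 h2 h3
      · cases h
        rw [cs.wordProd_cons, h1]
      · obtain ⟨x, hx, rfl⟩ := Option.map_eq_some_iff.1 h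
        rw [cs.wordProd_cons, ih hx, cs.wordProd_cons, ← mul_assoc, ← mul_assoc, simple_comm h2]
      · obtain ⟨x, hx, rfl⟩ := Option.map_eq_some_iff.1 h
        obtain ⟨y, hy, hx⟩ := Option.bind_eq_some_iff.1 hx
        rw [cs.wordProd_cons, ih hy, ih hx, cs.wordProd_cons, cs.wordProd_cons]
        simp only [← mul_assoc]
        rw [simple_braid h3]

/-- A sufficient criterion for two words to have the same product. -/
def same : List (Fin 6) → List (Fin 6) → Bool
  | [], w => w.isEmpty
  | s :: v, w =>
    match pull w.length s w with
    | none => false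
    | some w' => same v w'

theorem wordProd_eq_of_same {v w : List (Fin 6)} (h : same v w) :
    cs.wordProd v = cs.wordProd w := by
  induction v generalizing w with
  | nil =>
    rw [same, List.isEmpty_iff] at h
    rw [h]
  | cons s v ih =>
    rw [same] at h
    split at h
    · simp at h
    · next w' hw => rw [wordProd_pull hw, cs.wordProd_cons, ih h]

/-- The action of the simple reflections on the 27 weights of the minuscule representation with
highest weight `0`. -/
def reflect : Fin 6 → Fin 27 → Fin 27 := ![
  ![1, 0, 2, 3, 4, 5, 6, 7, 8, 9, 12, 11, 10, 15, 14, 13, 17, 16, 19, 18, 21, 20, 22, 23, 24, 25,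
    26],
  ![0, 1, 2, 4, 3, 6, 5, 9, 8, 7, 10, 11, 12, 13, 14, 15, 16, 17, 20, 21, 18, 19, 23, 22, 24, 25,
    26],
  ![0, 2, 1, 3, 4, 5, 6, 7, 10, 9, 8, 13, 12, 11, 16, 15, 14, 17, 18, 22, 20, 23, 19, 21, 24, 25,
    26],
  ![0, 1, 3, 2, 4, 5, 8, 7, 6, 11, 10, 9, 12, 13, 14, 15, 18, 19, 16, 17, 20, 21, 22, 24, 23, 25,
    26],
  ![0, 1, 2, 5, 6, 3, 4, 7, 8, 9, 10, 14, 12, 16, 11, 17, 13, 15, 18, 19, 20, 21, 22, 23, 25, 24,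
    26],
  ![0, 1, 2, 3, 4, 7, 9, 5, 11, 6, 13, 8, 15, 10, 14, 12, 16, 17, 18, 19, 20, 21, 22, 23, 24, 26,
    25]]

theorem reflect_involutive (i : Fin 6) : Function.Involutive (reflect i) := by
  unfold Function.Involutive
  revert i
  decide +kernel

theorem isLiftable_reflect : E₆.IsLiftable fun i => (reflect_involutive i).toPerm := by
  unfold IsLiftable
  decide +kernel

/-- The permutation representation of `W(E₆)` on 27 points. -/
def perm : WE6 →* Equiv.Perm (Fin 27) :=
  cs.lift ⟨_, isLiftable_reflect⟩

theorem perm_simple (i : Fin 6) (a : Fin 27) : perm (cs.simple i) a = reflect i a := by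
  rw [perm, cs.lift_apply_simple]
  rfl

/-- The action of a word on the 27 points. -/
def act (w : List (Fin 6)) (a : Fin 27) : Fin 27 := w.foldr reflect a

theorem perm_wordProd (w : List (Fin 6)) (a : Fin 27) : perm (cs.wordProd w) a = act w a := by
  induction w with
  | nil => simp [act]
  | cons s w ih => rw [cs.wordProd_cons, map_mul, Equiv.Perm.mul_apply, ih, perm_simple]; rfl

/-- The parabolic subgroup generated by the simple reflections with labels in `J`. -/
def parabolic (J : List (Fin 6)) : Subgroup WE6 := Subgroup.closure (cs.simple '' {i | i ∈ J})

/-- The words `R` represent the left cosets of `parabolic K` in `parabolic J`, and the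
representatives are separated by their action on the point `b`, which `K` fixes. -/
def IsTransversal (J K : List (Fin 6)) (b : Fin 27) (R : List (List (Fin 6))) : Prop :=
  K ⊆ J ∧ (∀ k ∈ K, reflect k b = b) ∧ [] ∈ R ∧ (∀ r ∈ R, r ⊆ J) ∧
    (∀ r ∈ R, act r b = b → r = []) ∧
    ∀ s ∈ J, ∀ r ∈ R, (∃ r' ∈ R, act r' b = reflect s (act r b) ∧
      (same (s :: r') r ∨ same (s :: r) r')) ∨
      ∃ k ∈ K, same (s :: r) (r ++ [k])

instance (J K : List (Fin 6)) (b : Fin 27) (R : List (List (Fin 6))) :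
    Decidable (IsTransversal J K b R) := by
  unfold IsTransversal; infer_instance

/-- Coset representatives for type `D₅` in type `E₆`. -/
def repsE : List (List (Fin 6)) :=
  [[], [0], [2, 0], [3, 2, 0], [1, 3, 2, 0], [4, 3, 2, 0], [4, 1, 3, 2, 0], [5, 4, 3, 2, 0], [3,
   4, 1, 3, 2, 0], [5, 4, 1, 3, 2, 0], [2, 3, 4, 1, 3, 2, 0], [5, 3, 4, 1, 3, 2, 0], [0, 2, 3, 4,
   1, 3, 2, 0], [5, 2, 3, 4, 1, 3, 2, 0], [4, 5, 3, 4, 1, 3, 2, 0], [5, 0, 2, 3, 4, 1, 3, 2, 0],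
   [4, 5, 2, 3, 4, 1, 3, 2, 0], [4, 5, 0, 2, 3, 4, 1, 3, 2, 0], [3, 4, 5, 2, 3, 4, 1, 3, 2, 0],
   [3, 4, 5, 0, 2, 3, 4, 1, 3, 2, 0], [1, 3, 4, 5, 2, 3, 4, 1, 3, 2, 0], [1, 3, 4, 5, 0, 2, 3, 4,
   1, 3, 2, 0], [2, 3, 4, 5, 0, 2, 3, 4, 1, 3, 2, 0], [2, 1, 3, 4, 5, 0, 2, 3, 4, 1, 3, 2, 0],
   [3, 2, 1, 3, 4, 5, 0, 2, 3, 4, 1, 3, 2, 0], [4, 3, 2, 1, 3, 4, 5, 0, 2, 3, 4, 1, 3, 2, 0], [5,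
   4, 3, 2, 1, 3, 4, 5, 0, 2, 3, 4, 1, 3, 2, 0]]

/-- Coset representatives for type `A₄` in type `D₅`. -/
def repsD : List (List (Fin 6)) :=
  [[], [2], [3, 2], [1, 3, 2], [4, 3, 2], [4, 1, 3, 2], [5, 4, 3, 2], [3, 4, 1, 3, 2], [5, 4, 1,
   3, 2], [2, 3, 4, 1, 3, 2], [5, 3, 4, 1, 3, 2], [5, 2, 3, 4, 1, 3, 2], [4, 5, 3, 4, 1, 3, 2],
   [4, 5, 2, 3, 4, 1, 3, 2], [3, 4, 5, 2, 3, 4, 1, 3, 2], [1, 3, 4, 5, 2, 3, 4, 1, 3, 2]]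

set_option maxRecDepth 10000 in
theorem isTransversal_E : IsTransversal [0, 1, 2, 3, 4, 5] [1, 2, 3, 4, 5] 0 repsE := by
  decide +kernel

theorem isTransversal_D : IsTransversal [1, 2, 3, 4, 5] [1, 3, 4, 5] 1 repsD := by
  decide +kernel

theorem isTransversal_A₄ : IsTransversal [1, 3, 4, 5] [3, 4, 5] 21
    [[], [1], [3, 1], [4, 3, 1], [5, 4, 3, 1]] := by
  decide +kernel

theorem isTransversal_A₃ : IsTransversal [3, 4, 5] [4, 5] 19 [[], [3], [4, 3], [5, 4, 3]] := by
  decide +kernel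

theorem isTransversal_A₂ : IsTransversal [4, 5] [5] 17 [[], [4], [5, 4]] := by
  decide +kernel

theorem isTransversal_A₁ : IsTransversal [5] [] 15 [[], [5]] := by
  decide +kernel

/-- The orbit-stabilizer theorem for a subgroup acting on the 27 points. -/
theorem card_eq_card_mul_card {H S : Subgroup WE6} {b : Fin 27} {O : Finset (Fin 27)}
    (hS : ∀ y, y ∈ S ↔ y ∈ H ∧ perm y b = b) (hO : ∀ a, a ∈ O ↔ ∃ y ∈ H, perm y b = a) :
    Nat.card H = O.card * Nat.card S := by
  let : MulAction H (Fin 27) := MulAction.compHom (Fin 27) (perm.comp H.subtype)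
  have hsmul (y : H) (a : Fin 27) : y • a = perm y a := rfl
  have horb : MulAction.orbit H b = O := by
    ext a
    simp [MulAction.mem_orbit_iff, hsmul, hO]
  have hstab : MulAction.stabilizer H b = S.subgroupOf H := by
    ext y
    simp [MulAction.mem_stabilizer_iff, hsmul, Subgroup.mem_subgroupOf, hS]
  have hle : S ≤ H := fun y hy => ((hS y).1 hy).1
  have h1 := MulAction.index_stabilizer H b
  rw [horb, Set.ncard_coe_finset] at h1
  rw [← Subgroup.card_mul_index (MulAction.stabilizer H b), h1, hstab, mul_comm,
    Nat.card_congr (Subgroup.subgroupOfEquivOfLe hle).toEquiv]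

theorem simple_mem_parabolic {J : List (Fin 6)} {s : Fin 6} (hs : s ∈ J) :
    cs.simple s ∈ parabolic J :=
  Subgroup.subset_closure ⟨s, hs, rfl⟩

theorem wordProd_mem_parabolic {J w : List (Fin 6)} (hw : w ⊆ J) :
    cs.wordProd w ∈ parabolic J := by
  induction w with
  | nil => simp [one_mem]
  | cons s w ih =>
    rw [cs.wordProd_cons]
    exact mul_mem (simple_mem_parabolic (hw (by simp))) (ih fun a ha => hw (by simp [ha]))

theorem parabolic_le {J : List (Fin 6)} {H : Subgroup WE6} (h : ∀ s ∈ J, cs.simple s ∈ H) :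
    parabolic J ≤ H := by
  rw [parabolic, Subgroup.closure_le]
  rintro _ ⟨s, hs, rfl⟩
  exact h s hs

theorem perm_eq_self_of_mem_parabolic {K : List (Fin 6)} {b : Fin 27}
    (hb : ∀ k ∈ K, reflect k b = b) {y : WE6} (hy : y ∈ parabolic K) : perm y b = b := by
  have h : parabolic K ≤ (MulAction.stabilizer (Equiv.Perm (Fin 27)) b).comap perm :=
    parabolic_le fun s hs => by
      rw [Subgroup.mem_comap, MulAction.mem_stabilizer_iff, Equiv.Perm.smul_def, perm_simple,
        hb s hs]
  exact h hy

theorem parabolic_all : parabolic [0, 1, 2, 3, 4, 5] = ⊤ := by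
  rw [parabolic, ← cs.subgroup_closure_range_simple]
  congr 1
  ext y
  constructor
  · rintro ⟨s, -, rfl⟩
    exact ⟨s, rfl⟩
  · rintro ⟨s, rfl⟩
    exact ⟨s, by fin_cases s <;> simp, rfl⟩

theorem parabolic_nil : parabolic [] = ⊥ := by
  simp [parabolic]

namespace IsTransversal

variable {J K : List (Fin 6)} {b : Fin 27} {R : List (List (Fin 6))}

theorem exists_rep (h : IsTransversal J K b R) {y : WE6} (hy : y ∈ parabolic J) :
    ∃ r ∈ R, ∃ k ∈ parabolic K, y = cs.wordProd r * k := by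
  obtain ⟨-, -, hnil, -, -, hmul⟩ := h
  have key (s : Fin 6) (hs : s ∈ J) (y : WE6)
      (hy : ∃ r ∈ R, ∃ k ∈ parabolic K, y = cs.wordProd r * k) :
      ∃ r ∈ R, ∃ k ∈ parabolic K, cs.simple s * y = cs.wordProd r * k := by
    obtain ⟨r, hr, k, hk, rfl⟩ := hy
    rcases hmul s hs r hr with ⟨r', hr', -, h | h⟩ | ⟨l, hl, h⟩
    · refine ⟨r', hr', k, hk, ?_⟩
      rw [← wordProd_eq_of_same h, cs.wordProd_cons, ← mul_assoc, ← mul_assoc,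
        cs.simple_mul_simple_self, one_mul]
    · refine ⟨r', hr', k, hk, ?_⟩
      rw [← wordProd_eq_of_same h, cs.wordProd_cons, mul_assoc]
    · refine ⟨r, hr, cs.simple l * k, mul_mem (simple_mem_parabolic hl) hk, ?_⟩
      rw [← mul_assoc, ← cs.wordProd_cons, wordProd_eq_of_same h, cs.wordProd_append,
        cs.wordProd_singleton, mul_assoc]
  induction hy using Subgroup.closure_induction_left with
  | one => exact ⟨[], hnil, 1, one_mem _, by simp⟩
  | mul_left x hx y _ ih =>
    obtain ⟨s, hs, rfl⟩ := hx
    exact key s hs y ih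
  | inv_mul_cancel x hx y _ ih =>
    obtain ⟨s, hs, rfl⟩ := hx
    rw [cs.inv_simple]
    exact key s hs y ih

theorem exists_perm_eq (h : IsTransversal J K b R) {y : WE6} (hy : y ∈ parabolic J) :
    ∃ r ∈ R, perm y b = act r b := by
  obtain ⟨r, hr, k, hk, rfl⟩ := h.exists_rep hy
  refine ⟨r, hr, ?_⟩
  rw [map_mul, Equiv.Perm.mul_apply, perm_eq_self_of_mem_parabolic h.2.1 hk, perm_wordProd]

theorem mem_parabolic_iff (h : IsTransversal J K b R) (y : WE6) :
    y ∈ parabolic K ↔ y ∈ parabolic J ∧ perm y b = b := by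
  constructor
  · intro hy
    exact ⟨parabolic_le (fun s hs => simple_mem_parabolic (h.1 hs)) hy,
      perm_eq_self_of_mem_parabolic h.2.1 hy⟩
  · rintro ⟨hy, hb⟩
    obtain ⟨r, hr, k, hk, rfl⟩ := h.exists_rep hy
    rw [map_mul, Equiv.Perm.mul_apply, perm_eq_self_of_mem_parabolic h.2.1 hk,
      perm_wordProd] at hb
    rw [h.2.2.2.2.1 r hr hb, cs.wordProd_nil, one_mul]
    exact hk

theorem card_parabolic (h : IsTransversal J K b R) :
    Nat.card (parabolic J) = (R.map (act · b)).toFinset.card * Nat.card (parabolic K) := by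
  refine card_eq_card_mul_card h.mem_parabolic_iff fun a => ?_
  rw [List.mem_toFinset, List.mem_map]
  constructor
  · rintro ⟨r, hr, rfl⟩
    exact ⟨_, wordProd_mem_parabolic (h.2.2.2.1 r hr), perm_wordProd r b⟩
  · rintro ⟨y, hy, rfl⟩
    obtain ⟨r, hr, h⟩ := h.exists_perm_eq hy
    exact ⟨r, hr, h.symm⟩

end IsTransversal

theorem card_parabolic_A₄ : Nat.card (parabolic [1, 3, 4, 5]) = 120 := by
  rw [isTransversal_A₄.card_parabolic, isTransversal_A₃.card_parabolic,
    isTransversal_A₂.card_parabolic, isTransversal_A₁.card_parabolic, parabolic_nil,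
    Subgroup.card_bot]
  decide +kernel

theorem card_eq : Nat.card WE6 = 51840 := by
  rw [← Subgroup.card_top, ← parabolic_all, isTransversal_E.card_parabolic,
    isTransversal_D.card_parabolic, card_parabolic_A₄]
  decide +kernel

theorem mem_parabolic_A₄ {y : WE6} (h0 : perm y 0 = 0) (h1 : perm y 1 = 1) :
    y ∈ parabolic [1, 3, 4, 5] :=
  (isTransversal_D.mem_parabolic_iff y).2
    ⟨(isTransversal_E.mem_parabolic_iff y).2 ⟨by simp [parabolic_all], h0⟩, h1⟩

theorem eq_one_of_mem_parabolic_A₄ {y : WE6} (hy : y ∈ parabolic [1, 3, 4, 5])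
    (h : ∀ b ∈ [(21 : Fin 27), 19, 17, 15], perm y b = b) : y = 1 := by
  rw [← Subgroup.mem_bot, ← parabolic_nil, isTransversal_A₁.mem_parabolic_iff,
    isTransversal_A₂.mem_parabolic_iff, isTransversal_A₃.mem_parabolic_iff,
    isTransversal_A₄.mem_parabolic_iff]
  simp only [List.mem_cons, List.not_mem_nil, or_false, forall_eq_or_imp, forall_eq] at h
  exact ⟨⟨⟨⟨hy, h.1⟩, h.2.1⟩, h.2.2.1⟩, h.2.2.2⟩

theorem perm_injective : Function.Injective perm := by
  rw [injective_iff_map_eq_one]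
  intro y hy
  have h (a : Fin 27) : perm y a = a := by rw [hy]; rfl
  exact eq_one_of_mem_parabolic_A₄ (mem_parabolic_A₄ (h 0) (h 1)) fun b _ => h b

/-- A Coxeter element of the parabolic subgroup of type `A₄`. -/
def c : WE6 := cs.wordProd [1, 3, 4, 5]

theorem perm_c_pow (n : ℕ) (a : Fin 27) : perm (c ^ n) a = (act [1, 3, 4, 5])^[n] a := by
  induction n with
  | zero => simp
  | succ n ih =>
    rw [pow_succ', map_mul, Equiv.Perm.mul_apply, ih, Function.iterate_succ_apply', c,
      perm_wordProd]

theorem orderOf_c : orderOf c = 5 := by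
  have : Fact (Nat.Prime 5) := ⟨by norm_num⟩
  refine orderOf_eq_prime ?_ fun h => ?_
  · apply perm_injective
    ext a : 1
    rw [perm_c_pow, map_one, Equiv.Perm.one_apply]
    revert a
    decide +kernel
  · have h1 := perm_c_pow 1 21
    rw [pow_one, h, map_one, Equiv.Perm.one_apply] at h1
    revert h1
    decide +kernel

theorem commute_simple_zero_c : Commute (cs.simple 0) c := by
  apply perm_injective
  ext a : 1
  rw [map_mul, map_mul, Equiv.Perm.mul_apply, Equiv.Perm.mul_apply, c, perm_wordProd,
    perm_wordProd, perm_simple, perm_simple]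
  revert a
  decide +kernel

theorem perm_eq_or_of_commute_c {x : WE6} (hx : Commute x c) {a : Fin 27} (ha : a = 0 ∨ a = 1) :
    perm x a = 0 ∨ perm x a = 1 := by
  have hc (b : Fin 27) : perm c b = act [1, 3, 4, 5] b := perm_wordProd _ b
  have key : ∀ b : Fin 27, act [1, 3, 4, 5] b = b ↔ b = 0 ∨ b = 1 := by decide +kernel
  rw [← key, ← hc] at ha ⊢
  rw [← Equiv.Perm.mul_apply, ← map_mul, ← hx.eq, map_mul, Equiv.Perm.mul_apply, ha]

theorem mem_zpowers_c_of_perm_zero {x : WE6} (hx : Commute x c) (h0 : perm x 0 = 0) :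
    x ∈ Subgroup.zpowers c := by
  have h1 : perm x 1 = 1 := by
    refine (perm_eq_or_of_commute_c hx (Or.inr rfl)).resolve_left fun h => ?_
    have := (perm x).injective (h.trans h0.symm)
    revert this
    decide
  have hmem := mem_parabolic_A₄ h0 h1
  obtain ⟨r, hr, hxr⟩ := isTransversal_A₄.exists_perm_eq hmem
  have key : ∀ r ∈ [[], [1], [3, 1], [4, 3, 1], [5, 4, 3, 1]],
      ∃ n : Fin 5, act r 21 = (act [1, 3, 4, 5])^[n] 21 := by decide +kernel
  obtain ⟨n, hn⟩ := key r hr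
  rw [hn, ← perm_c_pow] at hxr
  have hc : c ∈ parabolic [1, 3, 4, 5] := wordProd_mem_parabolic (List.Subset.refl _)
  have hz : Commute ((c ^ (n : ℕ))⁻¹ * x) c :=
    ((Commute.refl c).pow_left n).inv_left.mul_left hx
  have hz21 : perm ((c ^ (n : ℕ))⁻¹ * x) 21 = 21 := by
    rw [map_mul, Equiv.Perm.mul_apply, hxr, ← Equiv.Perm.mul_apply, ← map_mul, inv_mul_cancel,
      map_one, Equiv.Perm.one_apply]
  have hz1 (m : ℕ) : perm ((c ^ (n : ℕ))⁻¹ * x) (perm (c ^ m) 21) = perm (c ^ m) 21 := by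
    rw [← Equiv.Perm.mul_apply, ← map_mul, (hz.pow_right m).eq, map_mul, Equiv.Perm.mul_apply,
      hz21]
  have hpts : ∀ b ∈ [(21 : Fin 27), 19, 17, 15], ∃ m : Fin 5, (act [1, 3, 4, 5])^[m] 21 = b := by
    decide +kernel
  have hone : (c ^ (n : ℕ))⁻¹ * x = 1 := by
    refine eq_one_of_mem_parabolic_A₄ (mul_mem (inv_mem (pow_mem hc _)) hmem) fun b hb => ?_
    obtain ⟨m, rfl⟩ := hpts b hb
    rw [← perm_c_pow]
    exact hz1 m
  rw [← inv_mul_eq_one.1 hone]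
  exact Subgroup.npow_mem_zpowers c n

theorem mem_zpowers_c_or {x : WE6} (hx : Commute x c) :
    x ∈ Subgroup.zpowers c ∨ cs.simple 0 * x ∈ Subgroup.zpowers c := by
  rcases perm_eq_or_of_commute_c hx (Or.inl rfl) with h | h
  · exact Or.inl (mem_zpowers_c_of_perm_zero hx h)
  · refine Or.inr (mem_zpowers_c_of_perm_zero (commute_simple_zero_c.mul_left hx) ?_)
    rw [map_mul, Equiv.Perm.mul_apply, h, perm_simple]
    decide +kernel

/-- Words commuting with the simple reflection `0` that move the point `0` to every point not
fixed by this reflection. -/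
def commutingWords : List (List (Fin 6)) :=
  let u : List (Fin 6) := [2, 3, 0, 2, 1, 3, 4, 3, 2, 1, 3, 0, 2]
  let l := [[], u, 5 :: u, 4 :: 5 :: u, 3 :: 4 :: 5 :: u, 1 :: 3 :: 4 :: 5 :: u]
  l ++ l.map (0 :: ·)

theorem exists_mem_commutingWords : ∀ a : Fin 27, reflect 0 a ≠ a →
    ∃ w ∈ commutingWords, act w 0 = a ∧ ∀ b, reflect 0 (act w b) = act w (reflect 0 b) := by
  decide +kernel

theorem card_centralizer_simple_zero :
    Nat.card (Subgroup.centralizer {(cs.simple 0 : WE6)}) = 1440 := by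
  have hcomm {y : WE6} : y ∈ Subgroup.centralizer {(cs.simple 0 : WE6)} ↔
      ∀ a, reflect 0 (perm y a) = perm y (reflect 0 a) := by
    rw [Subgroup.mem_centralizer_singleton_iff, ← perm_injective.eq_iff, Equiv.ext_iff]
    simp only [map_mul, Equiv.Perm.mul_apply, perm_simple]
    exact forall_congr' fun a => eq_comm
  have h01 : reflect 0 0 = 1 := by decide +kernel
  rw [card_eq_card_mul_card (S := parabolic [1, 3, 4, 5]) (b := 0)
    (O := Finset.univ.filter fun a => reflect 0 a ≠ a), card_parabolic_A₄]
  · decide +kernel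
  · intro y
    constructor
    · intro hy
      refine ⟨?_, perm_eq_self_of_mem_parabolic (by decide +kernel) hy⟩
      refine parabolic_le (fun s hs => ?_) hy
      rw [Subgroup.mem_centralizer_singleton_iff]
      refine simple_comm ?_
      revert s
      decide +kernel
    · rintro ⟨hy, h0⟩
      refine mem_parabolic_A₄ h0 ?_
      rw [← h01, ← hcomm.1 hy, h0]
  · intro a
    rw [Finset.mem_filter_univ]
    constructor
    · intro ha
      obtain ⟨w, -, hw, hw'⟩ := exists_mem_commutingWords a ha
      refine ⟨cs.wordProd w, hcomm.2 fun b => ?_, by rw [perm_wordProd, hw]⟩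
      rw [perm_wordProd, perm_wordProd, hw']
    · rintro ⟨y, hy, rfl⟩ h
      rw [hcomm.1 hy, h01] at h
      have := (perm y).injective h
      revert this
      decide

open scoped Pointwise in
/-- Every subgroup of order `5` is conjugate to the one generated by `c`. -/
theorem exists_conj_mem_zpowers {g : WE6} (hg : orderOf g = 5) :
    ∃ w : WE6, ∀ y, y ∈ Subgroup.zpowers c ↔ w * y * w⁻¹ ∈ Subgroup.zpowers g := by
  have : Fact (Nat.Prime 5) := ⟨by norm_num⟩
  have : Finite WE6 := Nat.finite_of_card_ne_zero (by rw [card_eq]; norm_num)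
  have hfac : (5 : ℕ) = 5 ^ (Nat.card WE6).factorization 5 := by
    rw [card_eq, show 51840 = 5 * 10368 from rfl,
      Nat.factorization_mul (by norm_num) (by norm_num), Finsupp.add_apply,
      Nat.Prime.factorization_self (by norm_num),
      Nat.factorization_eq_zero_of_not_dvd (by norm_num)]
    rfl
  obtain ⟨w, hw⟩ := MulAction.exists_smul_eq WE6
    (Sylow.ofCard (Subgroup.zpowers c) (by rw [Nat.card_zpowers, orderOf_c, ← hfac]))
    (Sylow.ofCard (Subgroup.zpowers g) (by rw [Nat.card_zpowers, hg, ← hfac]))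
  refine ⟨w, fun y => ?_⟩
  have h : MulAut.conj w • Subgroup.zpowers c = Subgroup.zpowers g :=
    congrArg Sylow.toSubgroup hw
  rw [← h, ← MulAut.conj_apply, ← MulAut.smul_def, Subgroup.smul_mem_pointwise_smul_iff]

/-- If `x ≠ 1` commutes with an element `g` of order `5` and no nontrivial power of `x` is a power
of `g`, then `x` is a reflection. -/
theorem eq_conj_of_commute {g x : WE6} (hg : orderOf g = 5) (hx : Commute x g)
    (h : ∀ n : ℕ, x ^ n ∈ Subgroup.zpowers g → x ^ n = 1) (hx1 : x ≠ 1) :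
    ∃ w : WE6, x = w * cs.simple 0 * w⁻¹ := by
  obtain ⟨w, hw⟩ := exists_conj_mem_zpowers hg
  have hconj : Commute (w⁻¹ * x * w) c := by
    have h1 : w * c * w⁻¹ ∈ Subgroup.zpowers g := (hw c).1 (Subgroup.mem_zpowers c)
    obtain ⟨n, hn⟩ := Subgroup.mem_zpowers_iff.1 h1
    have h2 : Commute x (w * c * w⁻¹) := hn ▸ hx.zpow_right n
    have h3 := (Commute.conj_iff w⁻¹).2 h2
    simpa [mul_assoc] using h3
  refine ⟨w, ?_⟩
  rcases mem_zpowers_c_or hconj with h1 | h1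
  · rw [hw] at h1
    have h2 := h 1 (by simpa [mul_assoc] using h1)
    exact absurd (by simpa using h2) hx1
  · set y := cs.simple 0 * (w⁻¹ * x * w) with hy
    have hxy : x = w * (cs.simple 0 * y) * w⁻¹ := by
      rw [hy, cs.simple_mul_simple_cancel_left]
      group
    have hty : Commute (cs.simple 0) y := by
      obtain ⟨n, hn⟩ := Subgroup.mem_zpowers_iff.1 h1
      exact hn ▸ commute_simple_zero_c.zpow_right n
    have hx2 : x ^ 2 = w * y ^ 2 * w⁻¹ := by
      rw [hxy, conj_pow, hty.mul_pow, cs.simple_sq, one_mul]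
    have hy2 : y ^ 2 = 1 := by
      have h2 := h 2 (by rw [hx2, ← hw]; exact pow_mem h1 2)
      rwa [hx2, conj_eq_one_iff] at h2
    have hy1 : y = 1 := by
      have h5 : y ^ 5 = 1 := by
        obtain ⟨n, hn⟩ := Subgroup.mem_zpowers_iff.1 h1
        rw [← hn, ← zpow_natCast, zpow_comm, zpow_natCast, ← orderOf_c, pow_orderOf_eq_one,
          one_zpow]
      calc y = y ^ 5 * ((y ^ 2) ^ 2)⁻¹ := by group
        _ = 1 := by rw [h5, hy2]; simp
    rw [hxy, hy1, mul_one]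

end WE6

/-- A subgroup of order `960` of the Weyl group `W(E₆)` containing a non-central element
of order `5` has trivial centralizer in `W(E₆)`. -/
theorem stmt_15 (G : Subgroup WE6) (hcard : Nat.card G = 960)
    (hg : ∃ g : G, orderOf g = 5 ∧ g ∉ Subgroup.center G) :
    Subgroup.centralizer (G : Set WE6) = ⊥ := by
  obtain ⟨g, hg5, hgc⟩ := hg
  have hg5' : orderOf (g : WE6) = 5 := by rw [Subgroup.orderOf_coe, hg5]
  rw [Subgroup.eq_bot_iff_forall]
  intro x hx
  by_contra hx1
  have hxG (a : WE6) (ha : a ∈ G) : Commute x a := (Subgroup.mem_centralizer_iff.1 hx a ha).symm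
  obtain ⟨w, rfl⟩ := WE6.eq_conj_of_commute hg5' (hxG g g.2) (fun n hn => by
    by_contra hne
    have : Fact (Nat.Prime 5) := ⟨by norm_num⟩
    refine hgc (Subgroup.mem_center_iff.2 fun a => Subtype.ext ?_)
    have hmem : (g : WE6) ∈ Subgroup.zpowers (x ^ n) := by
      have := mem_zpowers_of_prime_card (p := 5) (G := Subgroup.zpowers (g : WE6))
        (by rw [Nat.card_zpowers, hg5']) (g := ⟨x ^ n, hn⟩)
        (g' := ⟨g, Subgroup.mem_zpowers _⟩) (fun h => hne (congrArg Subtype.val h))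
      obtain ⟨k, hk⟩ := Subgroup.mem_zpowers_iff.1 this
      exact Subgroup.mem_zpowers_iff.2 ⟨k, congrArg Subtype.val hk⟩
    obtain ⟨k, hk⟩ := Subgroup.mem_zpowers_iff.1 hmem
    have := (((hxG a a.2).pow_left n).zpow_left k).symm
    rw [hk] at this
    exact this.eq) hx1
  have hle : G.map (MulAut.conj w⁻¹).toMonoidHom ≤
      Subgroup.centralizer {(WE6.cs.simple 0 : WE6)} := by
    rintro _ ⟨a, ha, rfl⟩
    rw [Subgroup.mem_centralizer_singleton_iff]
    have h := (Commute.conj_iff w⁻¹).2 (hxG a ha)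
    have h' : Commute (WE6.cs.simple 0) (w⁻¹ * a * w⁻¹⁻¹) := by simpa [mul_assoc] using h
    exact h'.symm.eq
  have hdvd := Subgroup.card_dvd_of_le hle
  rw [Nat.card_congr (G.equivMapOfInjective _ (MulAut.conj w⁻¹).injective).symm.toEquiv, hcard,
    WE6.card_centralizer_simple_zero] at hdvd
  revert hdvd
  decide
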